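/- For all a₁, a₂ ∈ ℝ and 1 ≤ p < ∞, the map Φ_{p;a₁,a₂} : P_o^n → C_p(ℝ^n) is a GL(n) covariant valuation; that is, Φ_{p;a₁,a₂}(K ∪ L) + Φ_{p;a₁,a₂}(K ∩ L) = Φ_{p;a₁,a₂}(K) + Φ_{p;a₁,a₂}(L) whenever K, L, K ∪ L, K ∩ L ∈ P_o^n, and Φ_{p;a₁,a₂}(φP)(x) = Φ_{p;a₁,a₂}(P)(φ^t x) for all φ ∈ GL(n). -/

import Mathlib

open scoped RealInnerProductSpace BigOperators Pointwise ENNReal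
open MeasureTheory Filter Matrix

noncomputable section

/-- `Euc n` is Euclidean space `ℝ^n`. -/
abbrev Euc (n : ℕ) := EuclideanSpace ℝ (Fin n)

/-- A convex body in `ℝ^n` containing the origin: a nonempty compact convex set with `0 ∈ K`. -/
def IsConvexBody0 {n : ℕ} (K : Set (Euc n)) : Prop :=
  IsCompact K ∧ Convex ℝ K ∧ (0 : Euc n) ∈ K

/-- A convex polytope in `ℝ^n` containing the origin. -/
def IsPolytope0 {n : ℕ} (P : Set (Euc n)) : Prop :=
  (∃ S : Finset (Euc n), P = convexHull ℝ (S : Set (Euc n))) ∧ (0 : Euc n) ∈ P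

/-- The support function `h_K(x) = sup { ⟪x, y⟫ : y ∈ K }`. -/
def supp {n : ℕ} (K : Set (Euc n)) (x : Euc n) : ℝ :=
  sSup ((fun y => ⟪x, y⟫) '' K)

/-- The image of a set under the linear map induced by a matrix. -/
def matAct {n : ℕ} (A : Matrix (Fin n) (Fin n) ℝ) (K : Set (Euc n)) : Set (Euc n) :=
  (Matrix.toEuclideanLin A) '' K

/-- The vector `A x`. -/
def matVec {n : ℕ} (A : Matrix (Fin n) (Fin n) ℝ) (x : Euc n) : Euc n :=
  Matrix.toEuclideanLin A x

/-- The dimension of a set: the dimension of (the direction of) its affine hull. -/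
def sdim {n : ℕ} (P : Set (Euc n)) : ℕ :=
  Module.finrank ℝ (affineSpan ℝ P).direction

/-- The set of `j`-dimensional faces of `P` containing the origin (faces of a polytope
being exactly its exposed faces). -/
def facesO {n : ℕ} (j : ℕ) (P : Set (Euc n)) : Set (Set (Euc n)) :=
  {F | IsExposed ℝ P F ∧ sdim F = j ∧ (0 : Euc n) ∈ F}

/-- The function-valued valuation `Φ_{p;a₁,a₂}`:
`Φ_{p;a₁,a₂}(P) = a₁ h_P^p + (a₂-a₁) Σ_{1≤j≤dim P-1} (-1)^j Σ_{F ∈ F_{j,o}(P)} h_F^p` if `dim P` is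
odd, and with leading coefficient `2a₂ - a₁` instead of `a₁` if `dim P` is even. -/
def PhiP {n : ℕ} (p a₁ a₂ : ℝ) (P : Set (Euc n)) : Euc n → ℝ := fun x =>
  (if Odd (sdim P) then a₁ else 2 * a₂ - a₁) * supp P x ^ p
    + (a₂ - a₁) * ∑ j ∈ Finset.Icc 1 (sdim P - 1),
        (-1 : ℝ) ^ j * ∑ᶠ F ∈ facesO j P, supp F x ^ p

section RelOpenCell

open scoped Topology

variable {E : Type*} [NormedAddCommGroup E] [InnerProductSpace ℝ E]

/-- A bounded relatively open convex set, presented as the intersection of a bounded open convex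
set `nhd` with the affine subspace through `base ∈ nhd` with direction `dir`. -/
structure RelOpenCell (E : Type*) [NormedAddCommGroup E] [InnerProductSpace ℝ E] where
  base : E
  dir : Submodule ℝ E
  nhd : Set E
  isOpen_nhd : IsOpen nhd
  convex_nhd : Convex ℝ nhd
  isBounded_nhd : Bornology.IsBounded nhd
  base_mem : base ∈ nhd

namespace RelOpenCell

/-- The underlying set of a cell. -/
def carrier (C : RelOpenCell E) : Set E := {u | u ∈ C.nhd ∧ u - C.base ∈ C.dir}

/-- The indicator function of a cell. -/
def ind (C : RelOpenCell E) : E → ℝ := C.carrier.indicator 1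

/-- The Euler characteristic with compact support of a cell. -/
def euler (C : RelOpenCell E) : ℝ := (-1) ^ Module.finrank ℝ C.dir

lemma base_mem_carrier (C : RelOpenCell E) : C.base ∈ C.carrier :=
  ⟨C.base_mem, by simp⟩

/-- The values attained on a cell by the functional `⟪w, ·⟫`. -/
def range (C : RelOpenCell E) (w : E) : Set ℝ := (fun u => ⟪w, u⟫) '' C.carrier

lemma convex_carrier (C : RelOpenCell E) : Convex ℝ C.carrier := by
  intro x hx y hy a b ha hb hab
  refine ⟨C.convex_nhd hx.1 hy.1 ha hb hab, ?_⟩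
  have : a • x + b • y - C.base = a • (x - C.base) + b • (y - C.base) := by
    have h : C.base = (a + b) • C.base := by rw [hab, one_smul]
    conv_lhs => rw [h]
    module
  rw [this]
  exact C.dir.add_mem (C.dir.smul_mem _ hx.2) (C.dir.smul_mem _ hy.2)

lemma ordConnected_range (C : RelOpenCell E) (w : E) : (C.range w).OrdConnected := by
  have : Convex ℝ (C.range w) := C.convex_carrier.linear_image (innerₛₗ ℝ w)
  exact this.ordConnected

lemma bddBelow_range (C : RelOpenCell E) (w : E) : BddBelow (C.range w) := by
  obtain ⟨R, hR⟩ := C.isBounded_nhd.exists_norm_le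
  refine ⟨-(‖w‖ * R), ?_⟩
  rintro _ ⟨u, hu, rfl⟩
  have h1 := abs_le.1 (abs_real_inner_le_norm w u)
  have h2 := mul_le_mul_of_nonneg_left (hR u hu.1) (norm_nonneg w)
  show -(‖w‖ * R) ≤ ⟪w, u⟫
  linarith [h1.1]

lemma isOpen_range (C : RelOpenCell E) (w : E) {v : E} (hv : v ∈ C.dir) (hwv : ⟪w, v⟫ ≠ 0) :
    IsOpen (C.range w) := by
  rw [isOpen_iff_mem_nhds]
  rintro _ ⟨u, hu, rfl⟩
  have hcont : Continuous fun s : ℝ => u + ((s - ⟪w, u⟫) / ⟪w, v⟫) • v := by fun_prop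
  have hmem : ∀ᶠ s in 𝓝 (⟪w, u⟫ : ℝ), u + ((s - ⟪w, u⟫) / ⟪w, v⟫) • v ∈ C.nhd := by
    refine hcont.continuousAt.eventually_mem (C.isOpen_nhd.mem_nhds ?_)
    simpa using hu.1
  filter_upwards [hmem] with s hs
  refine ⟨_, ⟨hs, ?_⟩, ?_⟩
  · rw [add_sub_right_comm]
    exact C.dir.add_mem hu.2 (C.dir.smul_mem _ hv)
  · simp only [inner_add_right, inner_smul_right]
    field_simp
    ring

lemma range_eq_singleton (C : RelOpenCell E) (w : E) (h : ∀ v ∈ C.dir, ⟪w, v⟫ = 0) :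
    C.range w = {⟪w, C.base⟫} := by
  refine Set.eq_singleton_iff_unique_mem.2 ⟨⟨_, C.base_mem_carrier, rfl⟩, ?_⟩
  rintro _ ⟨u, hu, rfl⟩
  have := h _ hu.2
  rw [inner_sub_right] at this
  show ⟪w, u⟫ = ⟪w, C.base⟫
  linarith

/-- The intersection of a cell with a hyperplane orthogonal to `w` through a point of the cell. -/
def slice (C : RelOpenCell E) (w c : E) (hc : c ∈ C.nhd) : RelOpenCell E where
  base := c
  dir := C.dir ⊓ (ℝ ∙ w)ᗮ
  nhd := C.nhd
  isOpen_nhd := C.isOpen_nhd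
  convex_nhd := C.convex_nhd
  isBounded_nhd := C.isBounded_nhd
  base_mem := hc

lemma exists_slice (C : RelOpenCell E) (w : E) (t : ℝ) :
    ∃ D : RelOpenCell E, t ∈ C.range w →
      D.dir = C.dir ⊓ (ℝ ∙ w)ᗮ ∧ D.base ∈ C.carrier ∧ ⟪w, D.base⟫ = t ∧
      D.carrier = {u | u ∈ C.carrier ∧ ⟪w, u⟫ = t} := by
  by_cases h : t ∈ C.range w
  · obtain ⟨c, hc, rfl⟩ := h
    refine ⟨C.slice w c hc.1, fun _ => ⟨rfl, hc, rfl, ?_⟩⟩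
    ext u
    simp only [carrier, slice, Set.mem_ofPred_eq, Submodule.mem_inf,
      Submodule.mem_orthogonal_singleton_iff_inner_right, inner_sub_right, sub_eq_zero, and_assoc]
    have : u - C.base = (u - c) + (c - C.base) := by abel
    rw [this, C.dir.add_mem_iff_left hc.2]
  · exact ⟨C, fun h' => absurd h' h⟩

/-- The jump from the value at a point to the right limit of the indicator function of the
shadow of a cell on a line, compared with the Euler characteristics of its slices. -/
lemma eventually_jump [FiniteDimensional ℝ E] (C : RelOpenCell E) (w : E) (t : ℝ) :
    ∀ᶠ δ in 𝓝[>] (0 : ℝ),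
      (-1 : ℝ) ^ Module.finrank ℝ (C.dir ⊓ (ℝ ∙ w)ᗮ : Submodule ℝ E) *
        ((C.range w).indicator 1 t - (C.range w).indicator 1 (t + δ)) =
      if t = sInf (C.range w) then C.euler else 0 := by
  have hpos : ∀ᶠ δ in 𝓝[>] (0 : ℝ), 0 < δ := eventually_mem_nhdsWithin
  have hne : (C.range w).Nonempty := ⟨_, _, C.base_mem_carrier, rfl⟩
  have hsmall : ∀ r > t, ∀ᶠ δ in 𝓝[>] (0 : ℝ), t + δ < r := by
    intro r hr
    have : Tendsto (fun δ : ℝ => t + δ) (𝓝[>] 0) (𝓝 (t + 0)) :=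
      (Continuous.tendsto (by fun_prop) 0).mono_left nhdsWithin_le_nhds
    exact this.eventually_lt_const (by simpa using hr)
  by_cases h : ∀ v ∈ C.dir, ⟪w, v⟫ = 0
  · have hdir : C.dir ⊓ (ℝ ∙ w)ᗮ = C.dir := inf_eq_left.2 fun v hv =>
      Submodule.mem_orthogonal_singleton_iff_inner_right.2 (h v hv)
    rw [hdir, C.range_eq_singleton w h, csInf_singleton]
    set a : ℝ := ⟪w, C.base⟫
    rcases lt_trichotomy t a with hta | rfl | hta
    · filter_upwards [hsmall a hta] with δ hδ
      simp [hta.ne, hδ.ne]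
    · filter_upwards [hpos] with δ hδ
      simp [hδ.ne', euler]
    · filter_upwards [hpos] with δ hδ
      have : t + δ ≠ a := by linarith
      simp [hta.ne', this]
  · push Not at h
    obtain ⟨v, hv, hwv⟩ := h
    have hopen := C.isOpen_range w hv hwv
    have hconn := C.ordConnected_range w
    have hbdd := C.bddBelow_range w
    have hinf : sInf (C.range w) ∉ C.range w := fun hmem => by
      obtain ⟨l, hl, hlt⟩ := (mem_nhdsLE_iff_exists_Ioc_subset.1
        (mem_nhdsWithin_of_mem_nhds (hopen.mem_nhds hmem)))
      obtain ⟨m, hm1, hm2⟩ := exists_between (Set.mem_Iio.1 hl)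
      exact absurd (csInf_le hbdd (hlt ⟨hm1, hm2.le⟩)) (not_le.2 hm2)
    have heuler : C.euler =
        -(-1 : ℝ) ^ Module.finrank ℝ (C.dir ⊓ (ℝ ∙ w)ᗮ : Submodule ℝ E) := by
      have hrank : Module.finrank ℝ (C.dir ⊓ (ℝ ∙ w)ᗮ : Submodule ℝ E) + 1 =
          Module.finrank ℝ C.dir := by
        let f : C.dir →ₗ[ℝ] ℝ := (innerₛₗ ℝ w).domRestrict C.dir
        have hf : f ≠ 0 := fun h0 => hwv (by simpa [f] using LinearMap.congr_fun h0 ⟨v, hv⟩)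
        have h1 := Module.Dual.finrank_ker_add_one_of_ne_zero (f := f) hf
        rw [← h1]
        congr 1
        have h2 : (LinearMap.ker f).map C.dir.subtype = C.dir ⊓ (ℝ ∙ w)ᗮ := by
          ext u
          simp [f, Submodule.mem_orthogonal_singleton_iff_inner_right, and_comm]
        rw [← h2]
        exact (Submodule.equivMapOfInjective _ C.dir.injective_subtype _).finrank_eq.symm
      rw [euler, ← hrank, pow_succ]
      ring
    by_cases htm : t ∈ C.range w
    · have hti : t ≠ sInf (C.range w) := fun h => hinf (h ▸ htm)
      have : ∀ᶠ δ in 𝓝[>] (0 : ℝ), t + δ ∈ C.range w := by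
        have : Tendsto (fun δ : ℝ => t + δ) (𝓝[>] 0) (𝓝 (t + 0)) :=
          (Continuous.tendsto (by fun_prop) 0).mono_left nhdsWithin_le_nhds
        exact this.eventually_mem (hopen.mem_nhds (by simpa using htm))
      filter_upwards [this] with δ hδ
      simp [htm, hδ, hti]
    · rcases lt_trichotomy t (sInf (C.range w)) with hta | hta | hta
      · filter_upwards [hsmall _ hta] with δ hδ
        have : t + δ ∉ C.range w := fun h => absurd (csInf_le hbdd h) (not_le.2 hδ)
        simp [htm, this, hta.ne]
      · obtain ⟨r, hr⟩ := hne
        have htr : t < r := lt_of_le_of_ne (hta ▸ csInf_le hbdd hr) fun h => htm (h ▸ hr)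
        filter_upwards [hsmall r htr, hpos] with δ hδ hδ0
        have : t + δ ∈ C.range w := by
          obtain ⟨q, hq, hqlt⟩ := exists_lt_of_csInf_lt ⟨r, hr⟩
            (show sInf (C.range w) < t + δ by linarith)
          exact hconn.out hq hr ⟨hqlt.le, hδ.le⟩
        rw [if_pos hta, heuler]
        simp [htm, this]
      · filter_upwards [hpos] with δ hδ
        have : t + δ ∉ C.range w := fun h => by
          obtain ⟨q, hq, hqlt⟩ := exists_lt_of_csInf_lt hne hta
          exact htm (hconn.out hq h ⟨hqlt.le, by linarith⟩)
        simp [htm, this, hta.ne']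

/-- A linear relation among indicator functions of cells in a translate of a `d`-dimensional
subspace holds among their Euler characteristics. -/
lemma sum_euler_eq_zero_of_finrank [FiniteDimensional ℝ E] {ι : Type*} (d : ℕ) :
    ∀ (V : Submodule ℝ E), Module.finrank ℝ V = d →
    ∀ (s : Finset ι) (a : ι → ℝ) (C : ι → RelOpenCell E),
      (∀ i ∈ s, (C i).dir ≤ V) → (∀ i ∈ s, ∀ j ∈ s, (C i).base - (C j).base ∈ V) →
      (∀ u, ∑ i ∈ s, a i * (C i).ind u = 0) → ∑ i ∈ s, a i * (C i).euler = 0 := by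
  classical
  induction d with
  | zero =>
    intro V hV s a C hdir hbase hsum
    rw [Submodule.finrank_eq_zero] at hV
    subst hV
    rcases s.eq_empty_or_nonempty with rfl | ⟨k, hk⟩
    · simp
    rw [← hsum (C k).base]
    refine Finset.sum_congr rfl fun i hi => ?_
    have h1 : (C i).dir = ⊥ := le_bot_iff.1 (hdir i hi)
    have h2 : (C i).base = (C k).base := by
      simpa [sub_eq_zero] using hbase i hi k hk
    have h3 : (C k).base ∈ (C i).carrier := h2 ▸ (C i).base_mem_carrier
    rw [euler, ind, h1]
    simp [h3]
  | succ d ih =>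
    intro V hV s a C hdir hbase hsum
    obtain ⟨w, hwV, hw0⟩ : ∃ w ∈ V, w ≠ 0 := by
      apply Submodule.exists_mem_ne_zero_of_ne_bot
      rintro rfl
      simp at hV
    have hV' : Module.finrank ℝ (V ⊓ (ℝ ∙ w)ᗮ : Submodule ℝ E) = d := by
      have h1 := Submodule.finrank_add_inf_finrank_orthogonal
        (K₁ := ℝ ∙ w) (K₂ := V) (by simpa using hwV)
      rw [finrank_span_singleton hw0, hV, inf_comm] at h1
      omega
    set r : ι → ℝ := fun i =>
      (-1) ^ Module.finrank ℝ ((C i).dir ⊓ (ℝ ∙ w)ᗮ : Submodule ℝ E) with hr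
    have hslice : ∀ t : ℝ, ∑ i ∈ s, a i * (r i * ((C i).range w).indicator 1 t) = 0 := by
      intro t
      choose D hD using fun i => (C i).exists_slice w t
      have key := ih _ hV' (s.filter fun i => t ∈ (C i).range w) a D ?_ ?_ ?_
      · rw [Finset.sum_filter] at key
        rw [← key]
        refine Finset.sum_congr rfl fun i _ => ?_
        by_cases hi : t ∈ (C i).range w
        · rw [if_pos hi, euler, (hD i hi).1]
          simp [hi, hr]
        · simp [hi]
      · intro i hi
        rw [Finset.mem_filter] at hi
        rw [(hD i hi.2).1]
        exact inf_le_inf_right _ (hdir i hi.1)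
      · intro i hi j hj
        rw [Finset.mem_filter] at hi hj
        obtain ⟨-, hi1, hi2, -⟩ := hD i hi.2
        obtain ⟨-, hj1, hj2, -⟩ := hD j hj.2
        refine ⟨?_, ?_⟩
        · have := V.sub_mem (V.add_mem (hdir i hi.1 hi1.2) (hbase i hi.1 j hj.1))
            (hdir j hj.1 hj1.2)
          rwa [sub_add_sub_cancel, sub_sub_sub_cancel_right] at this
        · simp [Submodule.mem_orthogonal_singleton_iff_inner_right, inner_sub_right, hi2, hj2]
      · intro u
        rw [Finset.sum_filter]
        by_cases hu : ⟪w, u⟫ = t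
        · refine Eq.trans ?_ (hsum u)
          refine Finset.sum_congr rfl fun i _ => ?_
          by_cases hi : t ∈ (C i).range w
          · simp [hi, ind, (hD i hi).2.2.2, hu, Set.indicator_apply]
          · have : u ∉ (C i).carrier := fun h => hi ⟨u, h, hu⟩
            simp [hi, ind, this]
        · refine Finset.sum_eq_zero fun i _ => ?_
          by_cases hi : t ∈ (C i).range w
          · simp [hi, ind, (hD i hi).2.2.2, hu]
          · simp [hi]
    set T : Finset ℝ := s.image fun i => sInf ((C i).range w) with hT
    have hev : ∀ᶠ δ in 𝓝[>] (0 : ℝ), ∀ i ∈ s, ∀ t ∈ T,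
        r i * (((C i).range w).indicator 1 t - ((C i).range w).indicator 1 (t + δ)) =
          if t = sInf ((C i).range w) then (C i).euler else 0 := by
      simp only [Filter.eventually_all_finset]
      exact fun i _ t _ => (C i).eventually_jump w t
    obtain ⟨δ, hδ⟩ := hev.exists
    have h1 : ∀ i ∈ s, a i * (C i).euler = ∑ t ∈ T, a i *
        (r i * (((C i).range w).indicator 1 t - ((C i).range w).indicator 1 (t + δ))) := by
      intro i hi
      rw [← Finset.mul_sum, Finset.sum_congr rfl (hδ i hi), Finset.sum_ite_eq',
        if_pos (Finset.mem_image_of_mem _ hi)]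
    rw [Finset.sum_congr rfl h1, Finset.sum_comm]
    refine Finset.sum_eq_zero fun t _ => ?_
    simp only [mul_sub, Finset.sum_sub_distrib, hslice, sub_zero]

lemma sum_euler_eq_zero [FiniteDimensional ℝ E] (c : RelOpenCell E →₀ ℝ)
    (hc : Finsupp.linearCombination ℝ ind c = 0) :
    Finsupp.linearCombination ℝ (euler (E := E)) c = 0 := by
  refine sum_euler_eq_zero_of_finrank (Module.finrank ℝ (⊤ : Submodule ℝ E)) ⊤ rfl c.support c id
    (fun _ _ => le_top) (fun _ _ _ _ => Submodule.mem_top) fun u => ?_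
  simpa [Finsupp.linearCombination_apply, Finsupp.sum, Finset.sum_apply] using congrFun hc u

end RelOpenCell

end RelOpenCell

section SupportFunction

variable {n : ℕ}

lemma le_supp {K : Set (Euc n)} (hK : IsCompact K) (x : Euc n) {y : Euc n} (hy : y ∈ K) :
    ⟪x, y⟫ ≤ supp K x :=
  le_csSup (hK.image (by fun_prop)).bddAbove ⟨y, hy, rfl⟩

lemma exists_eq_supp {K : Set (Euc n)} (hK : IsCompact K) (hne : K.Nonempty) (x : Euc n) :
    ∃ y ∈ K, ⟪x, y⟫ = supp K x :=
  (hK.image (f := fun y => ⟪x, y⟫) (by fun_prop)).sSup_mem (hne.image _)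

lemma supp_le {K : Set (Euc n)} (hne : K.Nonempty) {x : Euc n} {r : ℝ}
    (h : ∀ y ∈ K, ⟪x, y⟫ ≤ r) : supp K x ≤ r :=
  csSup_le (hne.image _) (by rintro _ ⟨y, hy, rfl⟩; exact h y hy)

lemma supp_union {K L : Set (Euc n)} (hK : IsCompact K) (hL : IsCompact L) (hKne : K.Nonempty)
    (hLne : L.Nonempty) (x : Euc n) : supp (K ∪ L) x = max (supp K x) (supp L x) := by
  rw [supp, Set.image_union]
  exact csSup_union (hK.image (by fun_prop)).bddAbove (hKne.image _)
    (hL.image (by fun_prop)).bddAbove (hLne.image _)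

lemma le_supp_inter {K L : Set (Euc n)} (hK : IsCompact K) (hL : IsCompact L)
    (hKne : K.Nonempty) (hLne : L.Nonempty) (hconv : Convex ℝ (K ∪ L)) (x : Euc n)
    (hle : supp K x ≤ supp L x) : supp K x ≤ supp (K ∩ L) x := by
  obtain ⟨y, hy, hyx⟩ := exists_eq_supp hK hKne x
  obtain ⟨z, hz, hzx⟩ := exists_eq_supp hL hLne x
  obtain ⟨w, hw, hwK, hwL⟩ := isPreconnected_closed_iff.1 (convex_segment y z).isPreconnected
    K L hK.isClosed hL.isClosed (hconv.segment_subset (Or.inl hy) (Or.inr hz))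
    ⟨y, left_mem_segment ℝ y z, hy⟩ ⟨z, right_mem_segment ℝ y z, hz⟩
  refine le_trans ?_ (le_supp (hK.inter hL) x ⟨hwK, hwL⟩)
  have hhalf : Convex ℝ {u : Euc n | supp K x ≤ ⟪x, u⟫} :=
    convex_halfSpace_ge (innerₛₗ ℝ x).isLinear _
  exact hhalf.segment_subset hyx.ge (hle.trans hzx.ge) hw

lemma supp_inter {K L : Set (Euc n)} (hK : IsCompact K) (hL : IsCompact L)
    (hne : (K ∩ L).Nonempty) (hconv : Convex ℝ (K ∪ L)) (x : Euc n) :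
    supp (K ∩ L) x = min (supp K x) (supp L x) := by
  have hKne := hne.mono Set.inter_subset_left
  have hLne := hne.mono Set.inter_subset_right
  refine le_antisymm (le_min (supp_le hne fun y hy => le_supp hK x hy.1)
    (supp_le hne fun y hy => le_supp hL x hy.2)) ?_
  rcases le_total (supp K x) (supp L x) with h | h
  · rw [min_eq_left h]
    exact le_supp_inter hK hL hKne hLne hconv x h
  · rw [min_eq_right h, Set.inter_comm]
    exact le_supp_inter hL hK hLne hKne (Set.union_comm K L ▸ hconv) x h

lemma supp_rpow_union_add_inter {K L : Set (Euc n)} (hK : IsCompact K) (hL : IsCompact L)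
    (hne : (K ∩ L).Nonempty) (hconv : Convex ℝ (K ∪ L)) (x : Euc n) (p : ℝ) :
    supp (K ∪ L) x ^ p + supp (K ∩ L) x ^ p = supp K x ^ p + supp L x ^ p := by
  rw [supp_union hK hL (hne.mono Set.inter_subset_left) (hne.mono Set.inter_subset_right),
    supp_inter hK hL hne hconv]
  rcases le_total (supp K x) (supp L x) with h | h
  · rw [max_eq_right h, min_eq_left h, add_comm]
  · rw [max_eq_left h, min_eq_right h]

lemma supp_zero_singleton (x : Euc n) : supp ({0} : Set (Euc n)) x = 0 := by
  simp [supp]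

end SupportFunction

section Polytope

open scoped Topology

variable {n : ℕ}

lemma IsPolytope0.isCompact {P : Set (Euc n)} (hP : IsPolytope0 P) : IsCompact P := by
  obtain ⟨⟨S, rfl⟩, -⟩ := hP
  exact S.finite_toSet.isCompact_convexHull ℝ

lemma IsPolytope0.convex {P : Set (Euc n)} (hP : IsPolytope0 P) : Convex ℝ P := by
  obtain ⟨⟨S, rfl⟩, -⟩ := hP
  exact convex_convexHull ℝ _

lemma sdim_eq_finrank_span {F : Set (Euc n)} (h0 : (0 : Euc n) ∈ F) :
    sdim F = Module.finrank ℝ (Submodule.span ℝ F) := by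
  have h : (fun x : Euc n => x -ᵥ 0) '' F = F := by simp
  rw [sdim, direction_affineSpan, vectorSpan_eq_span_vsub_set_right ℝ h0, h]

/-- The part of `P` on the hyperplane orthogonal to `u`; a face of `P` when `⟪u, ·⟫ ≤ 0` on `P`. -/
def touchFace (P : Set (Euc n)) (u : Euc n) : Set (Euc n) := {y | y ∈ P ∧ ⟪u, y⟫ = 0}

/-- The faces of `P` containing the origin. -/
def originFaces (P : Set (Euc n)) : Set (Set (Euc n)) := {F | IsExposed ℝ P F ∧ (0 : Euc n) ∈ F}

/-- The open unit part of the normal cone of `P` at the origin. -/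
def unitNormals (P : Set (Euc n)) : Set (Euc n) := {u | ‖u‖ < 1 ∧ ∀ y ∈ P, ⟪u, y⟫ ≤ 0}

lemma touchFace_mem_originFaces {P : Set (Euc n)} (h0 : (0 : Euc n) ∈ P) {u : Euc n}
    (hu : u ∈ unitNormals P) : touchFace P u ∈ originFaces P := by
  refine ⟨fun _ => ⟨InnerProductSpace.toDual ℝ _ u, ?_⟩, h0, inner_zero_right u⟩
  ext y
  simp only [touchFace, Set.mem_ofPred_eq, InnerProductSpace.toDual_apply_apply]
  refine and_congr_right fun hy => ⟨fun h z hz => h ▸ hu.2 z hz, fun h => ?_⟩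
  have := h 0 h0
  rw [inner_zero_right] at this
  exact le_antisymm (hu.2 y hy) this

lemma exists_unitNormal {P F : Set (Euc n)} (hF : F ∈ originFaces P) :
    ∃ u ∈ unitNormals P, touchFace P u = F := by
  obtain ⟨hexp, h0⟩ := hF
  obtain ⟨l, hl⟩ := hexp ⟨0, h0⟩
  set v := (InnerProductSpace.toDual ℝ (Euc n)).symm l with hv
  have hlv : ∀ y, l y = ⟪v, y⟫ := fun y => by simp [hv]
  have hle : ∀ y ∈ P, ⟪v, y⟫ ≤ 0 := fun y hy => by
    rw [hl] at h0
    simpa [hlv] using h0.2 y hy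
  have hr : (0 : ℝ) < (1 + ‖v‖)⁻¹ := by positivity
  refine ⟨(1 + ‖v‖)⁻¹ • v, ⟨?_, fun y hy => ?_⟩, ?_⟩
  · rw [norm_smul, Real.norm_of_nonneg hr.le, inv_mul_lt_one₀ (by positivity)]
    linarith
  · rw [real_inner_smul_left]
    exact mul_nonpos_of_nonneg_of_nonpos hr.le (hle y hy)
  · ext y
    simp only [touchFace, Set.mem_ofPred_eq, real_inner_smul_left, mul_eq_zero, hr.ne', false_or]
    constructor
    · rintro ⟨hy, h⟩
      rw [hl]
      refine ⟨hy, fun z hz => ?_⟩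
      rw [hlv, hlv, h]
      exact hle z hz
    · intro hy
      rw [hl] at hy
      refine ⟨hy.1, le_antisymm (hle y hy.1) ?_⟩
      have := hy.2 0 (by rw [hl] at h0; exact h0.1)
      simpa [hlv] using this

lemma inner_nonpos_of_mem_convexHull {S : Set (Euc n)} {u y : Euc n}
    (hu : ∀ v ∈ S, ⟪u, v⟫ ≤ 0) (hy : y ∈ convexHull ℝ S) : ⟪u, y⟫ ≤ 0 :=
  convexHull_min (t := {z : Euc n | ⟪u, z⟫ ≤ 0}) hu
    (convex_halfSpace_le (innerₛₗ ℝ u).isLinear 0) hy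

/-- If every vertex on the hyperplane orthogonal to `u` is orthogonal to `c`, the same holds for
every point of the polytope. -/
lemma inner_eq_zero_of_mem_convexHull {S : Finset (Euc n)} {u c : Euc n}
    (hu : ∀ v ∈ S, ⟪u, v⟫ ≤ 0) (hc : ∀ v ∈ S, ⟪c, v⟫ ≤ 0)
    (h : ∀ v ∈ S, ⟪u, v⟫ = 0 → ⟪c, v⟫ = 0) {y : Euc n}
    (hy : y ∈ convexHull ℝ (S : Set (Euc n))) (huy : ⟪u, y⟫ = 0) : ⟪c, y⟫ = 0 := by
  have hev : ∀ᶠ ε in 𝓝[>] (0 : ℝ), ∀ v ∈ S, ⟪u - ε • c, v⟫ ≤ 0 := by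
    simp only [Filter.eventually_all_finset]
    intro v hv
    rcases (hu v hv).lt_or_eq with hlt | heq
    · have : Tendsto (fun ε : ℝ => ⟪u - ε • c, v⟫) (𝓝[>] 0) (𝓝 ⟪u - (0 : ℝ) • c, v⟫) :=
        (Continuous.tendsto (by fun_prop) 0).mono_left nhdsWithin_le_nhds
      refine (this.eventually_lt_const ?_).mono fun ε hε => hε.le
      simpa using hlt
    · filter_upwards with ε
      simp [inner_sub_left, real_inner_smul_left, heq, h v hv heq]
  obtain ⟨ε, hε, hε0⟩ := (hev.and eventually_mem_nhdsWithin).exists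
  have h1 := inner_nonpos_of_mem_convexHull hε hy
  rw [inner_sub_left, real_inner_smul_left, huy] at h1
  refine le_antisymm (inner_nonpos_of_mem_convexHull hc hy) ?_
  exact nonneg_of_mul_nonneg_right (by linarith) (Set.mem_Ioi.1 hε0)

lemma IsPolytope0.finite_originFaces {P : Set (Euc n)} (hP : IsPolytope0 P) :
    (originFaces P).Finite := by
  obtain ⟨⟨S, rfl⟩, -⟩ := hP
  refine Set.Finite.of_finite_image (f := fun F => (S : Set (Euc n)) ∩ F)
    (S.finite_toSet.finite_subsets.subset ?_) ?_
  · rintro _ ⟨F, -, rfl⟩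
    exact Set.inter_subset_left
  · suffices h : ∀ F ∈ originFaces (convexHull ℝ (S : Set (Euc n))),
        ∀ G ∈ originFaces (convexHull ℝ (S : Set (Euc n))),
        (S : Set (Euc n)) ∩ F = (S : Set (Euc n)) ∩ G → F ⊆ G from
      fun F hF G hG hFG => (h F hF G hG hFG).antisymm (h G hG F hF hFG.symm)
    intro F hF G hG hFG y hy
    obtain ⟨u, hu, rfl⟩ := exists_unitNormal hF
    obtain ⟨c, hc, rfl⟩ := exists_unitNormal hG
    have hS := subset_convexHull ℝ (S : Set (Euc n))
    refine ⟨hy.1, inner_eq_zero_of_mem_convexHull (fun v hv => hu.2 v (hS hv))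
      (fun v hv => hc.2 v (hS hv)) (fun v hv huv => ?_) hy.1 hy.2⟩
    exact (hFG.subset ⟨hv, hS hv, huv⟩).2.2

/-- The unit normals exposing a given face through the origin form a cell in the orthogonal
complement of that face. -/
lemma IsPolytope0.exists_normalCell {P F : Set (Euc n)} (hP : IsPolytope0 P)
    (hF : F ∈ originFaces P) :
    ∃ C : RelOpenCell (Euc n), C.carrier = {u | u ∈ unitNormals P ∧ touchFace P u = F} ∧
      C.dir = (Submodule.span ℝ F)ᗮ := by
  obtain ⟨⟨S, rfl⟩, h0⟩ := hP
  have hS := subset_convexHull ℝ (S : Set (Euc n))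
  obtain ⟨c, hc, rfl⟩ := exists_unitNormal hF
  set F := touchFace (convexHull ℝ (S : Set (Euc n))) c with hFdef
  have horth : ∀ u : Euc n, u ∈ (Submodule.span ℝ F)ᗮ ↔ ∀ y ∈ F, ⟪u, y⟫ = 0 := by
    intro u
    rw [Submodule.mem_orthogonal']
    refine ⟨fun h y hy => h y (Submodule.subset_span hy), fun h y hy => ?_⟩
    have : Submodule.span ℝ F ≤ LinearMap.ker (innerₛₗ ℝ u) :=
      Submodule.span_le.2 fun y hy => by simpa using h y hy
    simpa using this hy
  have hcorth : c ∈ (Submodule.span ℝ F)ᗮ := (horth c).2 fun y hy => hy.2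
  set U : Set (Euc n) := Metric.ball 0 1 ∩
    ⋂ v ∈ {v | v ∈ (S : Set (Euc n)) ∧ v ∉ F}, {u | ⟪u, v⟫ < 0} with hU
  have hmemU : ∀ u, u ∈ U ↔ ‖u‖ < 1 ∧ ∀ v ∈ S, v ∉ F → ⟪u, v⟫ < 0 := by
    intro u
    simp [hU]
  refine ⟨⟨c, (Submodule.span ℝ F)ᗮ, U, ?_, ?_, ?_, ?_⟩, ?_, rfl⟩
  · refine Metric.isOpen_ball.inter (Set.Finite.isOpen_biInter
      (S.finite_toSet.subset fun v hv => hv.1) fun v _ => ?_)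
    exact isOpen_lt (by fun_prop) continuous_const
  · refine (convex_ball 0 1).inter (convex_iInter₂ fun v _ => ?_)
    simp only [real_inner_comm v]
    exact convex_halfSpace_lt (innerₛₗ ℝ v).isLinear 0
  · exact Metric.isBounded_ball.subset Set.inter_subset_left
  · exact (hmemU c).2 ⟨hc.1, fun v hv hvF =>
      (hc.2 v (hS hv)).lt_of_ne fun h => hvF ⟨hS hv, h⟩⟩
  · ext u
    simp only [RelOpenCell.carrier, Set.mem_ofPred_eq, hmemU]
    rw [Submodule.sub_mem_iff_left _ hcorth, horth]
    constructor
    · rintro ⟨⟨hu1, hu2⟩, hu3⟩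
      have huS : ∀ v ∈ S, ⟪u, v⟫ ≤ 0 := fun v hv => by
        by_cases hvF : v ∈ F
        · exact (hu3 v hvF).le
        · exact (hu2 v hv hvF).le
      refine ⟨⟨hu1, fun y hy => inner_nonpos_of_mem_convexHull huS hy⟩, ?_⟩
      refine Set.Subset.antisymm (fun y hy => ⟨hy.1, ?_⟩) fun y hy => ⟨hy.1, hu3 y hy⟩
      refine inner_eq_zero_of_mem_convexHull huS (fun v hv => hc.2 v (hS hv))
        (fun v hv huv => ?_) hy.1 hy.2
      by_contra hcv
      exact (hu2 v hv fun hvF => hcv hvF.2).ne huv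
    · rintro ⟨hu, huF⟩
      refine ⟨⟨hu.1, fun v hv hvF => (hu.2 v (hS hv)).lt_of_ne fun h => hvF ?_⟩, fun y hy => ?_⟩
      · exact huF ▸ ⟨hS hv, h⟩
      · rw [← huF] at hy
        exact hy.2

open Classical in
/-- The alternating sum over the faces of a polytope through the origin is, up to sign, the
integral of `g (touchFace P u)` over the unit normals with respect to the Euler characteristic. -/
lemma IsPolytope0.exists_linearCombination_cells {P : Set (Euc n)} (hP : IsPolytope0 P)
    (g : Set (Euc n) → ℝ) :
    ∃ c : RelOpenCell (Euc n) →₀ ℝ,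
      Finsupp.linearCombination ℝ RelOpenCell.ind c =
        (unitNormals P).indicator (fun u => g (touchFace P u)) ∧
      Finsupp.linearCombination ℝ RelOpenCell.euler c =
        (-1) ^ n * ∑ F ∈ hP.finite_originFaces.toFinset, (-1) ^ sdim F * g F := by
  have hcell : ∀ F, ∃ C : RelOpenCell (Euc n), F ∈ originFaces P →
      C.carrier = {u | u ∈ unitNormals P ∧ touchFace P u = F} ∧
        C.dir = (Submodule.span ℝ F)ᗮ := by
    intro F
    by_cases hF : F ∈ originFaces P
    · obtain ⟨C, hC⟩ := hP.exists_normalCell hF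
      exact ⟨C, fun _ => hC⟩
    · exact ⟨⟨0, ⊥, Metric.ball 0 1, Metric.isOpen_ball, convex_ball _ _, Metric.isBounded_ball,
        by simp⟩, fun h => absurd h hF⟩
  choose C hC using hcell
  refine ⟨∑ F ∈ hP.finite_originFaces.toFinset, Finsupp.single (C F) (g F), ?_, ?_⟩
  · rw [map_sum]
    ext u
    simp only [Finsupp.linearCombination_single, Finset.sum_apply, Pi.smul_apply, smul_eq_mul]
    by_cases hu : u ∈ unitNormals P
    · have hmem : touchFace P u ∈ hP.finite_originFaces.toFinset :=
        hP.finite_originFaces.mem_toFinset.2 (touchFace_mem_originFaces hP.2 hu)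
      rw [Set.indicator_of_mem hu, Finset.sum_eq_single_of_mem _ hmem]
      · rw [RelOpenCell.ind, (hC _ (hP.finite_originFaces.mem_toFinset.1 hmem)).1]
        simp [hu]
      · intro F hF hne
        rw [RelOpenCell.ind, (hC _ (hP.finite_originFaces.mem_toFinset.1 hF)).1]
        simp [hne.symm]
    · rw [Set.indicator_of_notMem hu]
      refine Finset.sum_eq_zero fun F hF => ?_
      rw [RelOpenCell.ind, (hC _ (hP.finite_originFaces.mem_toFinset.1 hF)).1]
      simp [hu]
  · rw [map_sum, Finset.mul_sum]
    refine Finset.sum_congr rfl fun F hF => ?_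
    have hF' := hP.finite_originFaces.mem_toFinset.1 hF
    rw [Finsupp.linearCombination_single, RelOpenCell.euler, (hC F hF').2,
      sdim_eq_finrank_span hF'.2]
    have h := Submodule.finrank_add_finrank_orthogonal (Submodule.span ℝ F)
    rw [finrank_euclideanSpace_fin] at h
    have hsq : ((-1 : ℝ) ^ Module.finrank ℝ (Submodule.span ℝ F)) ^ 2 = 1 := by
      rw [← pow_mul, mul_comm, pow_mul]
      simp
    have hn : (-1 : ℝ) ^ n = (-1) ^ Module.finrank ℝ (Submodule.span ℝ F) *
        (-1) ^ Module.finrank ℝ (Submodule.span ℝ F)ᗮ := by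
      rw [← pow_add, h]
    rw [hn, smul_eq_mul]
    linear_combination (-(-1 : ℝ) ^ Module.finrank ℝ (Submodule.span ℝ F)ᗮ * g F) * hsq

lemma IsPolytope0.sdim_lt_of_mem_originFaces {P F : Set (Euc n)} (hP : IsPolytope0 P)
    (hF : F ∈ originFaces P) (hne : F ≠ P) : sdim F < sdim P := by
  obtain ⟨u, hu, rfl⟩ := exists_unitNormal hF
  rw [sdim_eq_finrank_span hF.2, sdim_eq_finrank_span hP.2]
  have hsub : touchFace P u ⊆ P := fun y hy => hy.1
  refine Submodule.finrank_lt_finrank_of_lt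
    ((Submodule.span_mono hsub).lt_of_not_ge fun hle => hne (hsub.antisymm fun y hy => ⟨hy, ?_⟩))
  have h1 : Submodule.span ℝ (touchFace P u) ≤ LinearMap.ker (innerₛₗ ℝ u) :=
    Submodule.span_le.2 fun z hz => by simpa using hz.2
  simpa using h1 (hle (Submodule.subset_span hy))

lemma supp_eq_zero_of_sdim_eq_zero {F : Set (Euc n)} (h0 : (0 : Euc n) ∈ F) (hF : sdim F = 0)
    (x : Euc n) : supp F x = 0 := by
  rw [sdim_eq_finrank_span h0, Submodule.finrank_eq_zero, Submodule.span_eq_bot] at hF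
  rw [Set.eq_singleton_iff_unique_mem.2 ⟨h0, hF⟩, supp_zero_singleton]

lemma PhiP_eq_sum_originFaces {P : Set (Euc n)} (hP : IsPolytope0 P) {p : ℝ} (hp : p ≠ 0)
    (a₁ a₂ : ℝ) (x : Euc n) :
    PhiP p a₁ a₂ P x = a₂ * supp P x ^ p +
      (a₂ - a₁) * ∑ F ∈ hP.finite_originFaces.toFinset, (-1) ^ sdim F * supp F x ^ p := by
  classical
  set 𝓕 := hP.finite_originFaces.toFinset with h𝓕
  have hmem : ∀ F, F ∈ 𝓕 ↔ F ∈ originFaces P := fun F => hP.finite_originFaces.mem_toFinset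
  have hinner : ∀ j : ℕ, (-1 : ℝ) ^ j * ∑ᶠ F ∈ facesO j P, supp F x ^ p =
      ∑ F ∈ 𝓕 with sdim F = j, (-1) ^ sdim F * supp F x ^ p := by
    intro j
    have : facesO j P = ((𝓕.filter fun F => sdim F = j : Finset _) : Set (Set (Euc n))) := by
      ext F
      simp only [facesO, Finset.coe_filter, hmem, originFaces, Set.mem_ofPred_eq]
      tauto
    rw [this, finsum_mem_coe_finset, Finset.mul_sum]
    refine Finset.sum_congr rfl fun F hF => ?_
    rw [(Finset.mem_filter.1 hF).2]
  have hPmem : P ∈ 𝓕 := (hmem P).2 ⟨IsExposed.refl P, hP.2⟩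
  have hsplit : ∑ F ∈ 𝓕, (-1 : ℝ) ^ sdim F * supp F x ^ p = (-1) ^ sdim P * supp P x ^ p +
      ∑ j ∈ Finset.Icc 1 (sdim P - 1), (-1 : ℝ) ^ j * ∑ᶠ F ∈ facesO j P, supp F x ^ p := by
    simp only [hinner]
    rw [Finset.sum_fiberwise_eq_sum_filter, Finset.sum_filter, ← Finset.add_sum_erase _ _ hPmem,
      ← Finset.add_sum_erase _ _ hPmem]
    have hdim : sdim P ∉ Finset.Icc 1 (sdim P - 1) := by
      rw [Finset.mem_Icc]
      omega
    rw [if_neg hdim, zero_add]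
    congr 1
    refine Finset.sum_congr rfl fun F hF => ?_
    rw [Finset.mem_erase, hmem] at hF
    have hlt := hP.sdim_lt_of_mem_originFaces hF.2 hF.1
    split_ifs with h
    · rfl
    · rw [Finset.mem_Icc] at h
      rw [supp_eq_zero_of_sdim_eq_zero hF.2.2 (by omega), Real.zero_rpow hp, mul_zero]
  rw [hsplit, PhiP]
  split_ifs with hodd
  · rw [hodd.neg_one_pow]
    ring
  · rw [(Nat.not_odd_iff_even.1 hodd).neg_one_pow]
    ring

lemma unitNormals_union (K L : Set (Euc n)) :
    unitNormals (K ∪ L) = unitNormals K ∩ unitNormals L := by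
  ext u
  simp only [unitNormals, Set.mem_ofPred_eq, Set.mem_union, Set.mem_inter_iff, or_imp,
    forall_and]
  tauto

/-- If `u` is normal to `K` but not to `L`, and `K ∪ L` is convex, the face of `K` in direction
`u` lies in `L`. -/
lemma touchFace_subset_of_notMem {K L : Set (Euc n)} (hL : IsClosed L)
    (hconv : Convex ℝ (K ∪ L)) {u : Euc n} (hu : u ∈ unitNormals K) (huL : u ∉ unitNormals L) :
    touchFace K u ⊆ L := by
  obtain ⟨z, hz, huz⟩ : ∃ z ∈ L, 0 < ⟪u, z⟫ := by
    by_contra! h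
    exact huL ⟨hu.1, h⟩
  intro y hy
  have hmem : ∀ᶠ t in 𝓝[>] (0 : ℝ), y + t • (z - y) ∈ L := by
    filter_upwards [Ioo_mem_nhdsGT (zero_lt_one' ℝ)] with t ht
    refine (hconv.add_smul_sub_mem (Or.inl hy.1) (Or.inr hz) ⟨ht.1.le, ht.2.le⟩).resolve_left
      fun hK => ?_
    have h1 := hu.2 _ hK
    rw [inner_add_right, inner_smul_right, inner_sub_right, hy.2] at h1
    have := mul_pos ht.1 huz
    linarith
  have hlim : Tendsto (fun t : ℝ => y + t • (z - y)) (𝓝[>] 0) (𝓝 (y + (0 : ℝ) • (z - y))) :=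
    (Continuous.tendsto (by fun_prop) 0).mono_left nhdsWithin_le_nhds
  simpa using hL.mem_of_tendsto hlim hmem

lemma mem_or_mem_of_mem_unitNormals_inter {K L : Set (Euc n)} (hK : IsCompact K)
    (hL : IsCompact L) (hne : (K ∩ L).Nonempty) (hconv : Convex ℝ (K ∪ L)) {u : Euc n}
    (hu : u ∈ unitNormals (K ∩ L)) : u ∈ unitNormals K ∨ u ∈ unitNormals L := by
  have h1 : supp (K ∩ L) u ≤ 0 := supp_le hne hu.2
  rw [supp_inter hK hL hne hconv, min_le_iff] at h1
  exact h1.imp (fun h => ⟨hu.1, fun y hy => (le_supp hK u hy).trans h⟩)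
    (fun h => ⟨hu.1, fun y hy => (le_supp hL u hy).trans h⟩)

lemma isCompact_touchFace {K : Set (Euc n)} (hK : IsCompact K) (u : Euc n) :
    IsCompact (touchFace K u) :=
  hK.inter_right (isClosed_eq (f := fun y => ⟪u, y⟫) (by fun_prop) continuous_const)

lemma convex_touchFace {K : Set (Euc n)} (hK : Convex ℝ K) (u : Euc n) :
    Convex ℝ (touchFace K u) :=
  hK.inter (convex_hyperplane (innerₛₗ ℝ u).isLinear 0)

lemma touchFace_union (K L : Set (Euc n)) (u : Euc n) :
    touchFace (K ∪ L) u = touchFace K u ∪ touchFace L u :=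
  Set.union_inter_distrib_right K L _

lemma touchFace_inter (K L : Set (Euc n)) (u : Euc n) :
    touchFace (K ∩ L) u = touchFace K u ∩ touchFace L u :=
  Set.inter_inter_distrib_right K L _

lemma indicator_unitNormals_supp_add {K L : Set (Euc n)} (hK : IsCompact K) (hL : IsCompact L)
    (h0 : (0 : Euc n) ∈ K ∩ L) (hconv : Convex ℝ (K ∪ L)) (p : ℝ) (x : Euc n) :
    (unitNormals (K ∪ L)).indicator (fun u => supp (touchFace (K ∪ L) u) x ^ p) +
      (unitNormals (K ∩ L)).indicator (fun u => supp (touchFace (K ∩ L) u) x ^ p) =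
    (unitNormals K).indicator (fun u => supp (touchFace K u) x ^ p) +
      (unitNormals L).indicator (fun u => supp (touchFace L u) x ^ p) := by
  classical
  have hmono : ∀ {M N : Set (Euc n)}, M ⊆ N → unitNormals N ⊆ unitNormals M :=
    fun h u hu => ⟨hu.1, fun y hy => hu.2 y (h hy)⟩
  have hface : ∀ {M N : Set (Euc n)}, IsClosed N → Convex ℝ (M ∪ N) → ∀ {u : Euc n},
      u ∈ unitNormals M → u ∉ unitNormals N → touchFace (M ∩ N) u = touchFace M u := by
    intro M N hN hMN u hM hN'
    refine Set.Subset.antisymm (fun y hy => ⟨hy.1.1, hy.2⟩) fun y hy => ⟨⟨hy.1, ?_⟩, hy.2⟩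
    exact touchFace_subset_of_notMem hN hMN hM hN' hy
  ext u
  simp only [Pi.add_apply, unitNormals_union, Set.indicator_apply, Set.mem_inter_iff]
  by_cases hKu : u ∈ unitNormals K <;> by_cases hLu : u ∈ unitNormals L
  · have hI : u ∈ unitNormals (K ∩ L) := hmono Set.inter_subset_left hKu
    simp only [hKu, hLu, hI, and_self, if_true]
    rw [touchFace_union, touchFace_inter]
    refine supp_rpow_union_add_inter (isCompact_touchFace hK u) (isCompact_touchFace hL u)
      ⟨0, ?_⟩ ?_ x p
    · exact ⟨⟨h0.1, inner_zero_right u⟩, ⟨h0.2, inner_zero_right u⟩⟩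
    · rw [← touchFace_union]
      exact convex_touchFace hconv u
  · have hI : u ∈ unitNormals (K ∩ L) := hmono Set.inter_subset_left hKu
    simp [hKu, hLu, hI, hface hL.isClosed hconv hKu hLu]
  · have hI : u ∈ unitNormals (K ∩ L) := hmono Set.inter_subset_right hLu
    have := hface hK.isClosed (Set.union_comm K L ▸ hconv) hLu hKu
    rw [Set.inter_comm] at this
    simp [hKu, hLu, hI, this]
  · have hI : u ∉ unitNormals (K ∩ L) := fun h =>
      (mem_or_mem_of_mem_unitNormals_inter hK hL ⟨0, h0⟩ hconv h).elim hKu hLu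
    simp [hKu, hLu, hI]

lemma sum_originFaces_union_add_inter {K L : Set (Euc n)} (hK : IsPolytope0 K)
    (hL : IsPolytope0 L) (hU : IsPolytope0 (K ∪ L)) (hI : IsPolytope0 (K ∩ L)) (p : ℝ)
    (x : Euc n) :
    ∑ F ∈ hU.finite_originFaces.toFinset, (-1) ^ sdim F * supp F x ^ p +
      ∑ F ∈ hI.finite_originFaces.toFinset, (-1) ^ sdim F * supp F x ^ p =
    ∑ F ∈ hK.finite_originFaces.toFinset, (-1) ^ sdim F * supp F x ^ p +
      ∑ F ∈ hL.finite_originFaces.toFinset, (-1) ^ sdim F * supp F x ^ p := by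
  obtain ⟨cK, hK1, hK2⟩ := hK.exists_linearCombination_cells fun F => supp F x ^ p
  obtain ⟨cL, hL1, hL2⟩ := hL.exists_linearCombination_cells fun F => supp F x ^ p
  obtain ⟨cU, hU1, hU2⟩ := hU.exists_linearCombination_cells fun F => supp F x ^ p
  obtain ⟨cI, hI1, hI2⟩ := hI.exists_linearCombination_cells fun F => supp F x ^ p
  have h := RelOpenCell.sum_euler_eq_zero (cU + cI - (cK + cL)) (by
    rw [map_sub, map_add, map_add, hK1, hL1, hU1, hI1, sub_eq_zero]
    exact indicator_unitNormals_supp_add hK.isCompact hL.isCompact hI.2 hU.convex p x)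
  rw [map_sub, map_add, map_add, hK2, hL2, hU2, hI2, ← mul_add, ← mul_add, ← mul_sub,
    mul_eq_zero, sub_eq_zero] at h
  exact h.resolve_left (pow_ne_zero _ (by norm_num))

end Polytope

section Covariance

variable {n : ℕ}

lemma sdim_image (e : Euc n ≃ₗ[ℝ] Euc n) (P : Set (Euc n)) : sdim (e '' P) = sdim P := by
  have h : vectorSpan ℝ (e '' P) = (vectorSpan ℝ P).map e.toLinearMap :=
    (AffineMap.map_vectorSpan e.toLinearMap.toAffineMap).symm
  rw [sdim, sdim, direction_affineSpan, direction_affineSpan, h]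
  exact LinearEquiv.finrank_map_eq e _

lemma image_mem_facesO (e : Euc n ≃ₗ[ℝ] Euc n) {j : ℕ} {P F : Set (Euc n)}
    (hF : F ∈ facesO j P) : e '' F ∈ facesO j (e '' P) := by
  obtain ⟨hexp, hdim, h0⟩ := hF
  refine ⟨fun _ => ?_, by rw [sdim_image, hdim], 0, h0, map_zero e⟩
  obtain ⟨l, hl⟩ := hexp ⟨0, h0⟩
  refine ⟨l.comp (e.symm.toContinuousLinearEquiv : Euc n →L[ℝ] Euc n), ?_⟩
  rw [hl]
  ext y
  obtain ⟨z, rfl⟩ := e.surjective y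
  simp

lemma facesO_image (e : Euc n ≃ₗ[ℝ] Euc n) (j : ℕ) (P : Set (Euc n)) :
    facesO j (e '' P) = (fun F => e '' F) '' facesO j P := by
  refine Set.Subset.antisymm (fun F hF => ⟨e.symm '' F, ?_, ?_⟩) ?_
  · have := image_mem_facesO e.symm hF
    rwa [← Set.image_comp, show ⇑e.symm ∘ ⇑e = id from funext e.symm_apply_apply,
      Set.image_id] at this
  · show e '' (e.symm '' F) = F
    rw [← Set.image_comp, show ⇑e ∘ ⇑e.symm = id from funext e.apply_symm_apply, Set.image_id]
  · rintro _ ⟨F, hF, rfl⟩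
    exact image_mem_facesO e hF

lemma supp_matAct (A : Matrix (Fin n) (Fin n) ℝ) (F : Set (Euc n)) (x : Euc n) :
    supp (matAct A F) x = supp F (matVec Aᵀ x) := by
  rw [supp, supp, matAct, Set.image_image]
  congr 1
  refine Set.image_congr fun y _ => ?_
  rw [matVec, ← Matrix.conjTranspose_eq_transpose_of_trivial,
    Matrix.toEuclideanLin_conjTranspose_eq_adjoint, LinearMap.adjoint_inner_left]

lemma PhiP_matAct (p a₁ a₂ : ℝ) (φ : GL (Fin n) ℝ) (P : Set (Euc n)) (x : Euc n) :
    PhiP p a₁ a₂ (matAct (φ : Matrix (Fin n) (Fin n) ℝ) P) x =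
      PhiP p a₁ a₂ P (matVec ((φ : Matrix (Fin n) (Fin n) ℝ))ᵀ x) := by
  obtain ⟨e, he⟩ : ∃ e : Euc n ≃ₗ[ℝ] Euc n, ∀ F : Set (Euc n),
      matAct (φ : Matrix (Fin n) (Fin n) ℝ) F = e '' F := by
    refine ⟨LinearEquiv.ofInjectiveEndo (Matrix.toEuclideanLin (φ : Matrix (Fin n) (Fin n) ℝ)) ?_,
      fun F => rfl⟩
    refine Function.LeftInverse.injective
      (g := Matrix.toEuclideanLin ((φ⁻¹ : GL (Fin n) ℝ) : Matrix (Fin n) (Fin n) ℝ)) fun v => ?_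
    have h : ((φ⁻¹ : GL (Fin n) ℝ) : Matrix (Fin n) (Fin n) ℝ) * φ = 1 := φ.inv_mul
    ext i
    simp only [Matrix.toEuclideanLin, Matrix.toLpLin_apply, Matrix.mulVec_mulVec, h,
      Matrix.one_mulVec]
  have hsupp : ∀ F, supp (e '' F) x = supp F (matVec (φ : Matrix (Fin n) (Fin n) ℝ)ᵀ x) :=
    fun F => by rw [← he, supp_matAct]
  simp only [PhiP, he, sdim_image, facesO_image, hsupp]
  congr 2
  refine Finset.sum_congr rfl fun j _ => ?_
  rw [finsum_mem_image (e.injective.image_injective.injOn)]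
  simp only [hsupp]

end Covariance

/-- Lemma 5.3: `Φ_{p;a₁,a₂}` is a `GL(n)` covariant valuation. -/
theorem PhiP_is_gln_covariant_valuation (n : ℕ) (p a₁ a₂ : ℝ) (hp : 1 ≤ p) :
    (∀ K L : Set (Euc n), IsPolytope0 K → IsPolytope0 L → IsPolytope0 (K ∪ L) →
      IsPolytope0 (K ∩ L) → ∀ x : Euc n,
      PhiP p a₁ a₂ (K ∪ L) x + PhiP p a₁ a₂ (K ∩ L) x
        = PhiP p a₁ a₂ K x + PhiP p a₁ a₂ L x) ∧
    (∀ (φ : GL (Fin n) ℝ) (P : Set (Euc n)), IsPolytope0 P → ∀ x : Euc n,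
      PhiP p a₁ a₂ (matAct (φ : Matrix (Fin n) (Fin n) ℝ) P) x
        = PhiP p a₁ a₂ P (matVec ((φ : Matrix (Fin n) (Fin n) ℝ))ᵀ x)) := by
  refine ⟨fun K L hK hL hU hI x => ?_, fun φ P _ x => PhiP_matAct p a₁ a₂ φ P x⟩
  have hp0 : p ≠ 0 := by linarith
  rw [PhiP_eq_sum_originFaces hK hp0, PhiP_eq_sum_originFaces hL hp0,
    PhiP_eq_sum_originFaces hU hp0, PhiP_eq_sum_originFaces hI hp0]
  have h1 := supp_rpow_union_add_inter hK.isCompact hL.isCompact ⟨0, hI.2⟩ hU.convex x p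
  have h2 := sum_originFaces_union_add_inter hK hL hU hI p x
  linear_combination a₂ * h1 + (a₂ - a₁) * h2
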